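/- Let Λ_A ⊂ [0,1] be the set of numbers whose base-N digit expansion is admissible for an irreducible 0-1 matrix A with A_{ii}=1. Then the Hausdorff dimension of Λ_A equals log r(A) / log N, where r(A) is the spectral radius of A. -/

import Mathlib

open MeasureTheory
open scoped BigOperators ENNReal

section Digits

variable {N : ℕ}

theorem ofDigits_mul_base (a : ℕ → Fin N) :
    Real.ofDigits a * N = a 0 + Real.ofDigits (fun k ↦ a (k + 1)) := by
  have hN : (N : ℝ) ≠ 0 := by exact_mod_cast (Fin.pos (a 0)).ne'
  rw [Real.ofDigits_eq_sum_add_ofDigits a 1]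
  simp only [Finset.range_one, Finset.sum_singleton, Real.ofDigitsTerm, zero_add, pow_one]
  field_simp

/-- The integer whose base-`N` digits, most significant first, are `a 0, …, a (n - 1)`. -/
def digitPrefix (a : ℕ → Fin N) : ℕ → ℤ
  | 0 => 0
  | n + 1 => N * digitPrefix a n + ((a n : ℕ) : ℤ)

theorem ofDigits_mul_base_pow (a : ℕ → Fin N) (n : ℕ) :
    Real.ofDigits a * (N : ℝ) ^ n = digitPrefix a n + Real.ofDigits (fun k ↦ a (k + n)) := by
  induction n with
  | zero => simp [digitPrefix]
  | succ n ih =>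
    have h := ofDigits_mul_base (fun k ↦ a (k + n))
    have hshift : (fun k ↦ a (k + 1 + n)) = fun k ↦ a (k + (n + 1)) := by
      funext k; congr 1; omega
    simp only [hshift, zero_add] at h
    rw [pow_succ, ← mul_assoc, ih, add_mul, h]
    push_cast [digitPrefix]
    ring

theorem eq_of_digitPrefix_eq {a b : ℕ → Fin N} {n : ℕ} (h : digitPrefix a n = digitPrefix b n) :
    ∀ k < n, a k = b k := by
  induction n with
  | zero => simp
  | succ n ih =>
    have hlast : a n = b n := by
      have hmod := congrArg (· % (N : ℤ)) h
      simp only [digitPrefix, Int.mul_add_emod_self_left] at hmod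
      rw [Int.emod_eq_of_lt (by positivity) (by exact_mod_cast (a n).isLt),
        Int.emod_eq_of_lt (by positivity) (by exact_mod_cast (b n).isLt)] at hmod
      exact Fin.ext (by exact_mod_cast hmod)
    have hN : (N : ℤ) ≠ 0 := by exact_mod_cast (Fin.pos (a 0)).ne'
    simp only [digitPrefix, hlast, add_left_inj] at h
    intro k hk
    rcases Nat.lt_succ_iff_lt_or_eq.1 hk with hk | rfl
    · exact ih (mul_left_cancel₀ hN h) k hk
    · exact hlast

theorem abs_digitPrefix_sub_le {a b : ℕ → Fin N} {n : ℕ}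
    (h : |Real.ofDigits a - Real.ofDigits b| ≤ ((N : ℝ) ^ n)⁻¹) :
    |digitPrefix a n - digitPrefix b n| ≤ 2 := by
  have hN : (0 : ℝ) < N := by exact_mod_cast Fin.pos (a 0)
  have hpow : (0 : ℝ) < (N : ℝ) ^ n := by positivity
  have hscaled : |Real.ofDigits a * (N : ℝ) ^ n - Real.ofDigits b * (N : ℝ) ^ n| ≤ 1 := by
    rw [← sub_mul, abs_mul, abs_of_pos hpow]
    calc _ ≤ ((N : ℝ) ^ n)⁻¹ * (N : ℝ) ^ n := by gcongr
      _ = 1 := inv_mul_cancel₀ hpow.ne'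
  rw [ofDigits_mul_base_pow, ofDigits_mul_base_pow, abs_le] at hscaled
  have ha := Real.ofDigits_nonneg (fun k ↦ a (k + n))
  have ha' := Real.ofDigits_le_one (fun k ↦ a (k + n))
  have hb := Real.ofDigits_nonneg (fun k ↦ b (k + n))
  have hb' := Real.ofDigits_le_one (fun k ↦ b (k + n))
  have hreal : |(digitPrefix a n : ℝ) - digitPrefix b n| ≤ 2 := by
    rw [abs_le]; constructor <;> linarith
  exact_mod_cast hreal

end Digits

section UpperBound

variable {N : ℕ} {A : Matrix (Fin N) (Fin N) ℝ} {r : ℝ} {p : Fin N → ℝ}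

theorem exists_finset_cover_admissible (hA01 : ∀ i j, A i j = 0 ∨ A i j = 1)
    (heig : ∀ i, ∑ j, A i j * p j = r * p i) {q : ℝ} (hq : ∀ i, q ≤ p i) (hq0 : 0 ≤ q) (n : ℕ)
    (i : Fin N) :
    ∃ F : Finset ℝ, (∀ a : ℕ → Fin N, (∀ k, A (a k) (a (k + 1)) = 1) → a 0 = i →
        ∃ x ∈ F, Real.ofDigits a ∈ Set.Icc x (x + ((N : ℝ) ^ n)⁻¹)) ∧
      F.card * q ≤ r ^ n * p i := by
  classical
  induction n generalizing i with
  | zero =>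
    refine ⟨{0}, fun a _ _ ↦ ⟨0, by simp, ?_⟩, by simpa using hq i⟩
    simpa using ⟨Real.ofDigits_nonneg a, Real.ofDigits_le_one a⟩
  | succ n ih =>
    choose F hF hcard using ih
    refine ⟨(Finset.univ.filter fun j ↦ A i j = 1).biUnion
      fun j ↦ (F j).image fun x ↦ ((i : ℝ) + x) / N, ?_, ?_⟩
    · rintro a ha rfl
      have hN : (0 : ℝ) < N := by exact_mod_cast Fin.pos (a 0)
      obtain ⟨x, hx, hmem⟩ := hF (a 1) (fun k ↦ a (k + 1)) (fun k ↦ ha (k + 1)) rfl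
      refine ⟨((a 0 : ℝ) + x) / N, ?_, ?_⟩
      · simp only [Finset.mem_biUnion, Finset.mem_filter, Finset.mem_univ, true_and,
          Finset.mem_image]
        exact ⟨a 1, ha 0, x, hx, rfl⟩
      · have hV : Real.ofDigits a = ((a 0 : ℝ) + Real.ofDigits (fun k ↦ a (k + 1))) / N := by
          rw [eq_div_iff hN.ne', ofDigits_mul_base]
        have hsplit : ((a 0 : ℝ) + x) / N + ((N : ℝ) ^ (n + 1))⁻¹
            = ((a 0 : ℝ) + (x + ((N : ℝ) ^ n)⁻¹)) / N := by
          rw [pow_succ]; field_simp; ring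
        rw [hV, hsplit]
        exact ⟨by gcongr; exact hmem.1, by gcongr; exact hmem.2⟩
    · calc _ ≤ ((∑ j with A i j = 1, (F j).card : ℕ) : ℝ) * q := by
            gcongr
            exact Finset.card_biUnion_le.trans (Finset.sum_le_sum fun j _ ↦ Finset.card_image_le)
        _ = ∑ j with A i j = 1, (F j).card * q := by rw [Nat.cast_sum, Finset.sum_mul]
        _ ≤ ∑ j with A i j = 1, r ^ n * p j := Finset.sum_le_sum fun j _ ↦ hcard j
        _ = ∑ j, r ^ n * (A i j * p j) := by
            rw [Finset.sum_filter]
            refine Finset.sum_congr rfl fun j _ ↦ ?_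
            rcases hA01 i j with h | h <;> simp [h]
        _ = r ^ (n + 1) * p i := by rw [← Finset.mul_sum, heig]; ring

/-- A set of reals covered, for each `n`, by at most `C * r ^ n` intervals of length `N ^ (-n)`
has dimension at most `log r / log N`. -/
theorem dimH_le_of_card_cover_le {s : Set ℝ} {C r b : ℝ} (hb : 1 < b) (hr : 1 ≤ r)
    (F : ℕ → Finset ℝ) (hF : ∀ n, ∀ x ∈ s, ∃ y ∈ F n, x ∈ Set.Icc y (y + (b ^ n)⁻¹))
    (hcard : ∀ n, ((F n).card : ℝ) ≤ C * r ^ n) :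
    dimH s ≤ ENNReal.ofReal (Real.log r / Real.log b) := by
  have hb0 : 0 < b := by linarith
  refine dimH_le fun d hd ↦ ?_
  by_contra! hlt
  have hd0 : 0 ≤ Real.log r / Real.log b :=
    div_nonneg (Real.log_nonneg hr) (Real.log_nonneg hb.le)
  have hlt' : Real.log r / Real.log b < d := by
    rwa [← ENNReal.ofReal_coe_nnreal, ENNReal.ofReal_lt_ofReal_iff_of_nonneg hd0] at hlt
  have hrb : r ≤ b ^ (d : ℝ) := by
    rw [← Real.log_le_log_iff (by linarith) (by positivity), Real.log_rpow hb0,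
      ← div_le_iff₀ (Real.log_pos hb)]
    exact hlt'.le
  have hlim : Filter.Tendsto (fun n : ℕ ↦ ENNReal.ofReal (b ^ n)⁻¹) Filter.atTop (nhds 0) := by
    rw [← ENNReal.ofReal_zero]
    exact ENNReal.tendsto_ofReal (tendsto_inv_atTop_zero.comp (tendsto_pow_atTop_atTop_of_one_lt hb))
  have hdiam : ∀ (n : ℕ) (y : ℝ),
      Metric.ediam (Set.Icc y (y + (b ^ n)⁻¹)) = ENNReal.ofReal (b ^ n)⁻¹ := by
    intro n y; rw [Real.ediam_Icc]; congr 1; ring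
  have hle := Measure.hausdorffMeasure_le_liminf_sum (d : ℝ) s (l := Filter.atTop) _ hlim
    (fun n (y : F n) ↦ Set.Icc (y : ℝ) (y + (b ^ n)⁻¹))
    (.of_forall fun n y ↦ (hdiam n y).le)
    (.of_forall fun n x hx ↦ by
      obtain ⟨y, hy, hxy⟩ := hF n x hx
      exact Set.mem_iUnion.2 ⟨⟨y, hy⟩, hxy⟩)
  rw [hd, top_le_iff] at hle
  have hbound : ∀ n : ℕ, ∑ y : F n, Metric.ediam (Set.Icc (y : ℝ) (y + (b ^ n)⁻¹)) ^ (d : ℝ)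
      ≤ ENNReal.ofReal C := by
    intro n
    simp only [hdiam]
    rw [Finset.sum_const, Finset.card_univ, Fintype.card_coe, nsmul_eq_mul,
      ENNReal.ofReal_rpow_of_nonneg (by positivity) d.coe_nonneg, ← ENNReal.ofReal_natCast,
      ← ENNReal.ofReal_mul (by positivity)]
    refine ENNReal.ofReal_le_ofReal ?_
    have hpow : ((b ^ n)⁻¹ : ℝ) ^ (d : ℝ) = ((b ^ (d : ℝ)) ^ n)⁻¹ := by
      rw [Real.inv_rpow (by positivity), ← Real.rpow_natCast, ← Real.rpow_natCast,
        ← Real.rpow_mul hb0.le, ← Real.rpow_mul hb0.le, mul_comm]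
    have hC : 0 ≤ C := by
      have h0 := hcard 0
      simp only [pow_zero, mul_one] at h0
      exact (Nat.cast_nonneg _).trans h0
    rw [hpow, ← div_eq_mul_inv, div_le_iff₀ (by positivity)]
    exact (hcard n).trans (by gcongr)
  have hlim_le := Filter.liminf_le_of_frequently_le' (f := Filter.atTop)
    (Filter.Frequently.of_forall hbound)
  rw [hle] at hlim_le
  exact ENNReal.ofReal_ne_top (top_le_iff.1 hlim_le)

end UpperBound

section LowerBound

variable {N : ℕ} {A : Matrix (Fin N) (Fin N) ℝ} {r : ℝ} {p : Fin N → ℝ}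

/-- Consecutive half-open intervals of lengths `w j` tile `[0, ∑ j, w j)`. -/
theorem exists_interval_tiling {n : ℕ} (w : Fin n → ℝ) :
    ∃ c : Fin n → ℝ, ∀ x ∈ Set.Ico 0 (∑ j, w j), ∃ j, x - c j ∈ Set.Ico 0 (w j) := by
  induction n with
  | zero => exact ⟨fun _ ↦ 0, fun x hx ↦ by simp at hx⟩
  | succ n ih =>
    obtain ⟨c, hc⟩ := ih fun j ↦ w j.succ
    refine ⟨Fin.cons 0 fun j ↦ w 0 + c j, fun x hx ↦ ?_⟩
    rw [Fin.sum_univ_succ] at hx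
    by_cases h : x < w 0
    · exact ⟨0, by simpa using ⟨hx.1, h⟩⟩
    · obtain ⟨j, hj⟩ := hc (x - w 0) ⟨by linarith, by linarith [hx.2]⟩
      exact ⟨j.succ, by simpa [sub_sub] using hj⟩

/-- The points of an interval can be coded by admissible sequences so that points whose codes
share `n` digits are within `O(r ^ (-n))` of each other. -/
theorem exists_admissible_coding (hA01 : ∀ i j, A i j = 0 ∨ A i j = 1) (hr : 1 ≤ r)
    (hp : ∀ i, 0 < p i) (heig : ∀ i, ∑ j, A i j * p j = r * p i) (i₀ : Fin N) :
    ∃ C : ℝ, 0 ≤ C ∧ ∃ a : ℝ → ℕ → Fin N, ∀ t ∈ Set.Ico 0 (p i₀),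
      (∀ k, A (a t k) (a t (k + 1)) = 1) ∧
      ∀ u ∈ Set.Ico 0 (p i₀), ∀ n, (∀ k < n, a t k = a u k) → |t - u| ≤ C / r ^ n := by
  have hr0 : 0 < r := by linarith
  choose c hc using fun i ↦ exists_interval_tiling fun j ↦ A i j * p j
  have hstep : ∀ s : {s : Fin N × ℝ // s.2 ∈ Set.Ico 0 (p s.1)},
      ∃ s' : {s : Fin N × ℝ // s.2 ∈ Set.Ico 0 (p s.1)},
        A s.1.1 s'.1.1 = 1 ∧ s'.1.2 = r * s.1.2 - c s.1.1 s'.1.1 := by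
    rintro ⟨⟨i, t⟩, ht⟩
    obtain ⟨j, hj⟩ := hc i (r * t) (by
      rw [heig]
      exact ⟨mul_nonneg hr0.le ht.1, mul_lt_mul_of_pos_left ht.2 hr0⟩)
    rcases hA01 i j with h | h
    · simp [h] at hj
    · exact ⟨⟨⟨j, r * t - c i j⟩, by simpa [h] using hj⟩, h, rfl⟩
  choose step hadm hval using hstep
  have hcode : ∀ t : ℝ, t ∈ Set.Ico 0 (p i₀) → ∃ (a : ℕ → Fin N) (τ : ℕ → ℝ), τ 0 = t ∧
      ∀ k, A (a k) (a (k + 1)) = 1 ∧ τ k ∈ Set.Ico 0 (p (a k)) ∧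
        τ (k + 1) = r * τ k - c (a k) (a (k + 1)) := by
    intro t ht
    refine ⟨fun k ↦ (step^[k] ⟨(i₀, t), ht⟩).1.1, fun k ↦ (step^[k] ⟨(i₀, t), ht⟩).1.2, rfl,
      fun k ↦ ?_⟩
    simp only [Function.iterate_succ_apply']
    exact ⟨hadm _, (step^[k] ⟨(i₀, t), ht⟩).2, hval _⟩
  have : Nonempty (Fin N) := ⟨i₀⟩
  choose! a τ hτ0 hτ using hcode
  set P := ∑ i, p i with hP
  have hpP : ∀ i, p i ≤ P := fun i ↦
    Finset.single_le_sum (fun j _ ↦ (hp j).le) (Finset.mem_univ i)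
  have hP0 : 0 < P := (hp i₀).trans_le (hpP i₀)
  refine ⟨P * r, by positivity, a, fun t ht ↦ ⟨fun k ↦ (hτ t ht k).1, fun u hu n hn ↦ ?_⟩⟩
  cases n with
  | zero =>
    rw [pow_zero, div_one, abs_le]
    have := hpP i₀
    have : P ≤ P * r := le_mul_of_one_le_right hP0.le hr
    constructor <;> linarith [ht.1, ht.2, hu.1, hu.2]
  | succ n =>
    have hexp : ∀ k ≤ n, τ t k - τ u k = r ^ k * (t - u) := by
      intro k
      induction k with
      | zero => intro _; rw [hτ0 t ht, hτ0 u hu]; simp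
      | succ k ih =>
        intro hk
        rw [(hτ t ht k).2.2, (hτ u hu k).2.2, hn k (by omega), hn (k + 1) (by omega), pow_succ]
        linear_combination r * ih (by omega)
    have htn := (hτ t ht n).2.1
    have hun := (hτ u hu n).2.1
    rw [← hn n (by omega)] at hun
    have habs : |r ^ n * (t - u)| ≤ P := by
      rw [← hexp n le_rfl, abs_le]
      have := hpP (a t n)
      constructor <;> linarith [htn.1, htn.2, hun.1, hun.2]
    rw [abs_mul, abs_of_pos (by positivity)] at habs
    rw [le_div_iff₀ (by positivity), pow_succ]
    nlinarith

theorem volume_le_of_digitPrefix_coding {S : Set ℝ} {a : ℝ → ℕ → Fin N} {C : ℝ}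
    (ha : ∀ t ∈ S, ∀ u ∈ S, ∀ n, (∀ k < n, a t k = a u k) → |t - u| ≤ C / r ^ n) {U : Set ℝ}
    {n : ℕ} (hU : ∀ x ∈ U, ∀ y ∈ U, |x - y| ≤ ((N : ℝ) ^ n)⁻¹) :
    volume ((fun t ↦ Real.ofDigits (a t)) ⁻¹' U ∩ S) ≤ 5 * ENNReal.ofReal (C / r ^ n) := by
  rcases ((fun t ↦ Real.ofDigits (a t)) ⁻¹' U ∩ S).eq_empty_or_nonempty with h | ⟨t₀, ht₀U, ht₀⟩
  · simp [h]
  have hsub : (fun t ↦ Real.ofDigits (a t)) ⁻¹' U ∩ S ⊆ ⋃ e ∈ Finset.Icc (-2 : ℤ) 2,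
      {t ∈ S | digitPrefix (a t) n = digitPrefix (a t₀) n + e} := by
    rintro t ⟨htU, ht⟩
    have h := abs_le.1 (abs_digitPrefix_sub_le (hU _ htU _ ht₀U))
    simp only [Set.mem_iUnion]
    exact ⟨digitPrefix (a t) n - digitPrefix (a t₀) n, Finset.mem_Icc.2 h, ht, by ring⟩
  calc _ ≤ _ := measure_mono hsub
    _ ≤ ∑ e ∈ Finset.Icc (-2 : ℤ) 2,
        volume {t ∈ S | digitPrefix (a t) n = digitPrefix (a t₀) n + e} :=
      measure_biUnion_finset_le _ _
    _ ≤ ∑ e ∈ Finset.Icc (-2 : ℤ) 2, ENNReal.ofReal (C / r ^ n) := by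
      refine Finset.sum_le_sum fun e _ ↦ (Real.volume_le_diam _).trans ?_
      refine Metric.ediam_le fun t ht u hu ↦ ?_
      rw [edist_dist, Real.dist_eq]
      exact ENNReal.ofReal_le_ofReal
        (ha t ht.1 u hu.1 n (eq_of_digitPrefix_eq (ht.2.trans hu.2.symm)))
    _ = _ := by simp

/-- A mass distribution principle along the scales `b ^ (-n)`. -/
theorem le_dimH_of_outerMeasure_le {s : Set ℝ} {r b K : ℝ} (hb : 1 < b) (hr : 1 < r) (hK : 0 < K)
    (ν : OuterMeasure ℝ) (hs : ν s ≠ 0)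
    (hν : ∀ (U : Set ℝ) (n : ℕ), (∀ x ∈ U, ∀ y ∈ U, |x - y| ≤ (b ^ n)⁻¹) →
      ν U ≤ ENNReal.ofReal (K / r ^ n)) :
    ENNReal.ofReal (Real.log r / Real.log b) ≤ dimH s := by
  have hb0 : 0 < b := by linarith
  have hr0 : 0 < r := by linarith
  set d : ℝ := Real.log r / Real.log b with hd
  have hdpos : 0 < d := div_pos (Real.log_pos hr) (Real.log_pos hb)
  have hbd : b ^ d = r := by
    rw [Real.rpow_def_of_pos hb0, hd, mul_div_cancel₀ _ (Real.log_pos hb).ne', Real.exp_log hr0]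
  set M : ℝ≥0∞ := ENNReal.ofReal (K * r) with hM
  have hM0 : M ≠ 0 := by simp only [hM, ne_eq, ENNReal.ofReal_eq_zero, not_le]; positivity
  have hMtop : M ≠ ∞ := ENNReal.ofReal_ne_top
  have hkey : ∀ U : Set ℝ, Metric.ediam U ≤ 1 → ν U ≤ M * Metric.ediam U ^ d := by
    intro U hU1
    have hUtop : Metric.ediam U ≠ ∞ := ne_top_of_le_ne_top ENNReal.one_ne_top hU1
    obtain ⟨D, hD0, hUD⟩ : ∃ D : ℝ, 0 ≤ D ∧ Metric.ediam U = ENNReal.ofReal D :=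
      ⟨_, ENNReal.toReal_nonneg, (ENNReal.ofReal_toReal hUtop).symm⟩
    have hdist : ∀ x ∈ U, ∀ y ∈ U, |x - y| ≤ D := by
      intro x hx y hy
      have h := Metric.edist_le_ediam_of_mem hx hy
      rwa [hUD, edist_dist, Real.dist_eq, ENNReal.ofReal_le_ofReal_iff hD0] at h
    rw [hUD, ENNReal.ofReal_le_one] at hU1
    rcases hD0.eq_or_lt with rfl | hDpos
    · have hlim : Filter.Tendsto (fun n : ℕ ↦ ENNReal.ofReal (K / r ^ n)) Filter.atTop
          (nhds 0) := by
        rw [← ENNReal.ofReal_zero]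
        exact ENNReal.tendsto_ofReal
          ((tendsto_pow_atTop_atTop_of_one_lt hr).const_div_atTop K)
      refine (ge_of_tendsto' hlim fun n ↦ hν U n fun x hx y hy ↦ ?_).trans zero_le
      exact (hdist x hx y hy).trans (by positivity)
    · obtain ⟨n, hn, hn'⟩ := exists_nat_pow_near_of_lt_one hDpos hU1 (inv_pos.2 hb0)
        (inv_lt_one_of_one_lt₀ hb)
      rw [inv_pow] at hn hn'
      refine (hν U n fun x hx y hy ↦ (hdist x hx y hy).trans hn').trans ?_
      rw [hUD, ENNReal.ofReal_rpow_of_pos hDpos, hM, ← ENNReal.ofReal_mul (by positivity)]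
      refine ENNReal.ofReal_le_ofReal ?_
      have hpow : (r ^ (n + 1))⁻¹ ≤ D ^ d := by
        have h := Real.rpow_le_rpow (by positivity) hn.le hdpos.le
        rwa [Real.inv_rpow (by positivity), ← Real.rpow_natCast, ← Real.rpow_mul hb0.le,
          mul_comm, Real.rpow_mul hb0.le, hbd, Real.rpow_natCast] at h
      calc K / r ^ n = K * r * (r ^ (n + 1))⁻¹ := by rw [pow_succ]; field_simp
        _ ≤ K * r * D ^ d := by gcongr
  have hle : M⁻¹ • ν ≤ OuterMeasure.mkMetric fun x : ℝ≥0∞ ↦ x ^ d := by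
    refine OuterMeasure.le_mkMetric _ _ 1 one_pos fun U hU ↦ ?_
    rw [smul_apply, smul_eq_mul, ENNReal.inv_mul_le_iff hM0 hMtop]
    exact hkey U hU
  have hmeas : M⁻¹ * ν s ≤ Measure.hausdorffMeasure d s := by
    rw [Measure.hausdorffMeasure, ← OuterMeasure.coe_mkMetric]
    exact hle s
  refine le_dimH_of_hausdorffMeasure_ne_zero (d := d.toNNReal) ?_
  rw [Real.coe_toNNReal _ hdpos.le]
  intro h0
  rw [h0, nonpos_iff_eq_zero, mul_eq_zero, ENNReal.inv_eq_zero] at hmeas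
  exact hmeas.elim hMtop hs

end LowerBound

/-- Let `Λ_A ⊂ [0,1]` be the set of numbers whose base-`N` digit expansion
is admissible for an irreducible 0-1 matrix `A` with `A_{ii} = 1`. Then the Hausdorff
dimension of `Λ_A` equals `log r(A) / log N`, where `r(A)` is the spectral radius of `A`
(realized as the Perron eigenvalue, with strictly positive eigenvector `p`). -/
theorem hausdorff_dimension_of_admissible_expansions
    {N : ℕ} (hN : 2 ≤ N) (A : Matrix (Fin N) (Fin N) ℝ)
    (hA01 : ∀ i j, A i j = 0 ∨ A i j = 1) (hAdiag : ∀ i, A i i = 1)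
    (hirr : ∃ n : ℕ, ∀ i j, 0 < (A ^ n) i j)
    (r : ℝ) (p : Fin N → ℝ) (hp : ∀ i, 0 < p i)
    (heig : ∀ i, ∑ j, A i j * p j = r * p i)
    (Λ : Set ℝ)
    (hΛ : Λ = {x | ∃ a : ℕ → Fin N, (∀ k, A (a k) (a (k + 1)) = 1) ∧
        x = ∑' k, (a k : ℝ) / (N : ℝ) ^ (k + 1)}) :
    dimH Λ = ENNReal.ofReal (Real.log r / Real.log N) := by
  subst hΛ
  simp only [div_eq_mul_inv (((_ : Fin N) : ℕ) : ℝ)]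
  change dimH {x | ∃ a : ℕ → Fin N, (∀ k, A (a k) (a (k + 1)) = 1) ∧ x = Real.ofDigits a} = _
  have hb : (1 : ℝ) < N := by exact_mod_cast hN
  let i₀ : Fin N := ⟨0, by omega⟩
  have : Nonempty (Fin N) := ⟨i₀⟩
  have hr : 1 ≤ r := by
    have hle : A i₀ i₀ * p i₀ ≤ r * p i₀ := by
      rw [← heig]
      refine Finset.single_le_sum (f := fun j ↦ A i₀ j * p j) (fun j _ ↦ ?_) (Finset.mem_univ i₀)
      rcases hA01 i₀ j with h | h <;> simp [h, (hp j).le]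
    rw [hAdiag] at hle
    exact le_of_mul_le_mul_right hle (hp i₀)
  apply le_antisymm
  · classical
    obtain ⟨m, hm⟩ := Finite.exists_min p
    choose F hF hcard using
      exists_finset_cover_admissible hA01 heig hm (hp m).le
    refine dimH_le_of_card_cover_le (C := (∑ i, p i) / p m) hb hr
      (fun n ↦ Finset.univ.biUnion (F n)) ?_ fun n ↦ ?_
    · rintro n _ ⟨a, ha, rfl⟩
      obtain ⟨x, hx, hmem⟩ := hF n (a 0) a ha rfl
      exact ⟨x, Finset.mem_biUnion.2 ⟨_, Finset.mem_univ _, hx⟩, hmem⟩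
    · rw [div_mul_eq_mul_div, le_div_iff₀ (hp m)]
      calc _ ≤ ((∑ i, (F n i).card : ℕ) : ℝ) * p m := by
            have := (hp m).le
            gcongr
            exact Finset.card_biUnion_le
        _ = ∑ i, (F n i).card * p m := by rw [Nat.cast_sum, Finset.sum_mul]
        _ ≤ ∑ i, r ^ n * p i := Finset.sum_le_sum fun i _ ↦ hcard n i
        _ = _ := by rw [← Finset.mul_sum, mul_comm]
  · rcases hr.eq_or_lt with rfl | hr1
    · simp
    obtain ⟨C, hC, a, ha⟩ := exists_admissible_coding hA01 hr hp heig i₀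
    refine le_dimH_of_outerMeasure_le (K := 5 * (C + 1)) hb hr1 (by positivity)
      (OuterMeasure.map (fun t ↦ Real.ofDigits (a t))
        (volume.restrict (Set.Ico 0 (p i₀))).toOuterMeasure) ?_ fun U n hU ↦ ?_
    · have hsub : Set.Ico 0 (p i₀) ⊆ (fun t ↦ Real.ofDigits (a t)) ⁻¹'
          {x | ∃ a : ℕ → Fin N, (∀ k, A (a k) (a (k + 1)) = 1) ∧ x = Real.ofDigits a} :=
        fun t ht ↦ ⟨a t, (ha t ht).1, rfl⟩
      rw [OuterMeasure.map_apply, Measure.coe_toOuterMeasure,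
        Measure.restrict_apply' measurableSet_Ico, Set.inter_eq_self_of_subset_right hsub]
      simpa using hp i₀
    · rw [OuterMeasure.map_apply, Measure.coe_toOuterMeasure,
        Measure.restrict_apply' measurableSet_Ico]
      refine (volume_le_of_digitPrefix_coding (fun t ht ↦ (ha t ht).2) hU).trans ?_
      rw [← ENNReal.ofReal_ofNat 5, ← ENNReal.ofReal_mul (by norm_num), ← mul_div_assoc]
      refine ENNReal.ofReal_le_ofReal ?_
      gcongr
      linarith
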